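/- Let q ∈ (-1,1) and let n ≥ 0 be an even integer. Then h_n(x|q) > 0 for all real x. -/

import Mathlib

/-- The q-Pochhammer symbol `(a;q)_k = ∏_{i=0}^{k-1} (1 - a q^i)`. -/
noncomputable def qPoch (a q : ℝ) (k : ℕ) : ℝ :=
  ∏ i ∈ Finset.range k, (1 - a * q ^ i)

/-- The q-binomial coefficient `[n choose l]_q = (q;q)_n / ((q;q)_l (q;q)_{n-l})`. -/
noncomputable def qBinom (q : ℝ) (n l : ℕ) : ℝ :=
  qPoch q q n / (qPoch q q l * qPoch q q (n - l))

/-- The Rogers–Szegő polynomial `h_n(x|q) = ∑_{l=0}^n [n choose l]_q x^l`. -/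
noncomputable def rogersSzego (q : ℝ) (n : ℕ) (x : ℝ) : ℝ :=
  ∑ l ∈ Finset.range (n + 1), qBinom q n l * x ^ l

theorem qPoch_succ (a q : ℝ) (k : ℕ) : qPoch a q (k + 1) = qPoch a q k * (1 - a * q ^ k) :=
  Finset.prod_range_succ _ _

theorem one_sub_mul_pow_pos {q : ℝ} (hq : q ∈ Set.Ioo (-1 : ℝ) 1) (k : ℕ) :
    0 < 1 - q * q ^ k := by
  have h : |q ^ (k + 1)| < 1 := by
    rw [abs_pow]
    exact pow_lt_one₀ (abs_nonneg q) (abs_lt.mpr hq) k.succ_ne_zero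
  have := (abs_lt.mp h).2
  rw [pow_succ'] at this
  linarith

theorem qPoch_self_pos {q : ℝ} (hq : q ∈ Set.Ioo (-1 : ℝ) 1) (k : ℕ) : 0 < qPoch q q k :=
  Finset.prod_pos fun i _ => one_sub_mul_pow_pos hq i

theorem qBinom_pos {q : ℝ} (hq : q ∈ Set.Ioo (-1 : ℝ) 1) (n l : ℕ) : 0 < qBinom q n l :=
  div_pos (qPoch_self_pos hq n) (mul_pos (qPoch_self_pos hq l) (qPoch_self_pos hq (n - l)))

theorem qBinom_zero_right {q : ℝ} (hq : q ∈ Set.Ioo (-1 : ℝ) 1) (n : ℕ) : qBinom q n 0 = 1 := by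
  have h := (qPoch_self_pos hq n).ne'
  have h0 : qPoch q q 0 = 1 := Finset.prod_range_zero _
  simp [qBinom, h0, h]

theorem qBinom_self {q : ℝ} (hq : q ∈ Set.Ioo (-1 : ℝ) 1) (n : ℕ) : qBinom q n n = 1 := by
  have h := (qPoch_self_pos hq n).ne'
  have h0 : qPoch q q 0 = 1 := Finset.prod_range_zero _
  simp [qBinom, h0, h]

theorem qBinom_add_two_succ {q : ℝ} (hq : q ∈ Set.Ioo (-1 : ℝ) 1) {n m : ℕ} (hm : m ≤ n) :
    qBinom q (n + 2) (m + 1) =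
      qBinom q (n + 1) (m + 1) + qBinom q (n + 1) m - (1 - q * q ^ n) * qBinom q n m := by
  obtain ⟨d, rfl⟩ := Nat.exists_eq_add_of_le hm
  have e₁ : m + d + 2 - (m + 1) = d + 1 := by omega
  have e₂ : m + d + 1 - (m + 1) = d := by omega
  have e₃ : m + d + 1 - m = d + 1 := by omega
  have e₄ : m + d - m = d := by omega
  simp only [qBinom, e₁, e₂, e₃, e₄, qPoch_succ]
  have hpm := (qPoch_self_pos hq m).ne'
  have hpd := (qPoch_self_pos hq d).ne'
  have hm' := (one_sub_mul_pow_pos hq m).ne'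
  have hd' := (one_sub_mul_pow_pos hq d).ne'
  field_simp
  ring

/-- The three-term recurrence of the Rogers–Szegő polynomials. -/
theorem rogersSzego_add_two {q : ℝ} (hq : q ∈ Set.Ioo (-1 : ℝ) 1) (n : ℕ) (x : ℝ) :
    rogersSzego q (n + 2) x =
      (1 + x) * rogersSzego q (n + 1) x - (1 - q * q ^ n) * x * rogersSzego q n x := by
  have h₂ : rogersSzego q (n + 2) x =
      ∑ m ∈ Finset.range (n + 1), qBinom q (n + 2) (m + 1) * x ^ (m + 1) + 1 + x ^ (n + 2) := by
    rw [rogersSzego, Finset.sum_range_succ, Finset.sum_range_succ', qBinom_zero_right hq,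
      qBinom_self hq]
    ring
  have h₁ : rogersSzego q (n + 1) x =
      ∑ m ∈ Finset.range (n + 1), qBinom q (n + 1) (m + 1) * x ^ (m + 1) + 1 := by
    rw [rogersSzego, Finset.sum_range_succ', qBinom_zero_right hq]
    ring
  have h₁' : x * rogersSzego q (n + 1) x =
      ∑ m ∈ Finset.range (n + 1), qBinom q (n + 1) m * x ^ (m + 1) + x ^ (n + 2) := by
    rw [rogersSzego, Finset.sum_range_succ, qBinom_self hq, mul_add, Finset.mul_sum]
    congr 1
    · exact Finset.sum_congr rfl fun m _ => by ring
    · ring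
  have h₀ : (1 - q * q ^ n) * x * rogersSzego q n x =
      ∑ m ∈ Finset.range (n + 1), (1 - q * q ^ n) * qBinom q n m * x ^ (m + 1) := by
    rw [rogersSzego, Finset.mul_sum]
    exact Finset.sum_congr rfl fun m _ => by ring
  have hsum : ∑ m ∈ Finset.range (n + 1), qBinom q (n + 2) (m + 1) * x ^ (m + 1) =
      ∑ m ∈ Finset.range (n + 1), qBinom q (n + 1) (m + 1) * x ^ (m + 1) +
        ∑ m ∈ Finset.range (n + 1), qBinom q (n + 1) m * x ^ (m + 1) -
        ∑ m ∈ Finset.range (n + 1), (1 - q * q ^ n) * qBinom q n m * x ^ (m + 1) := by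
    rw [← Finset.sum_add_distrib, ← Finset.sum_sub_distrib]
    refine Finset.sum_congr rfl fun m hm => ?_
    rw [qBinom_add_two_succ hq (Nat.lt_succ_iff.mp (Finset.mem_range.mp hm))]
    ring
  linear_combination h₂ - h₁ - h₁' + h₀ + hsum

theorem rogersSzego_pos_of_nonneg {q : ℝ} (hq : q ∈ Set.Ioo (-1 : ℝ) 1) (n : ℕ) {x : ℝ}
    (hx : 0 ≤ x) : 0 < rogersSzego q n x :=
  Finset.sum_pos' (fun l _ => mul_nonneg (qBinom_pos hq n l).le (pow_nonneg hx l))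
    ⟨0, by simp, by simpa using qBinom_pos hq n 0⟩

theorem rogersSzego_of_neg {q : ℝ} (hq : q ∈ Set.Ioo (-1 : ℝ) 1) {x : ℝ} (hx : x < 0) (k : ℕ) :
    0 < rogersSzego q (2 * k) x ∧ 0 ≤ (1 + x) * rogersSzego q (2 * k + 1) x := by
  induction k with
  | zero =>
    have h₀ : rogersSzego q 0 x = 1 := by simp [rogersSzego, qBinom_self hq]
    have h₁ : rogersSzego q 1 x = 1 + x := by
      simp [rogersSzego, Finset.sum_range_succ, qBinom_self hq, qBinom_zero_right hq]
    simp only [mul_zero, zero_add, h₀, h₁]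
    exact ⟨one_pos, mul_self_nonneg _⟩
  | succ k ih =>
    obtain ⟨heven, hodd⟩ := ih
    have hpos : 0 < rogersSzego q (2 * k + 2) x := by
      rw [rogersSzego_add_two hq]
      have := mul_pos (mul_pos (one_sub_mul_pow_pos hq (2 * k)) (neg_pos.mpr hx)) heven
      linarith
    refine ⟨hpos, ?_⟩
    change 0 ≤ (1 + x) * rogersSzego q (2 * k + 1 + 2) x
    rw [rogersSzego_add_two hq]
    have h₁ := mul_nonneg (mul_self_nonneg (1 + x)) hpos.le
    have h₂ := mul_nonneg
      (mul_pos (one_sub_mul_pow_pos hq (2 * k + 1)) (neg_pos.mpr hx)).le hodd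
    linear_combination h₁ + h₂

/-- For even `n ≥ 0`, `h_n(x|q) > 0` for all real `x`. -/
theorem rogersSzego_even_pos (q : ℝ) (hq : q ∈ Set.Ioo (-1 : ℝ) 1)
    (n : ℕ) (heven : Even n) (x : ℝ) :
    0 < rogersSzego q n x := by
  rcases le_or_gt 0 x with hx | hx
  · exact rogersSzego_pos_of_nonneg hq n hx
  · obtain ⟨k, rfl⟩ := heven.exists_two_nsmul
    exact (rogersSzego_of_neg hq hx k).1
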